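/- The metric space (𝒢₀, d) is locally path connected; in fact every open ball in 𝒢₀ is path connected. -/

import Mathlib

open scoped ENNReal
open Filter Topology

/-- Edges: 2-element subsets of the vertex set `ℕ`. -/
abbrev Edge : Type := {e : Sym2 ℕ // ¬ e.IsDiag}

/-- A labeled graph: an assignment of a real weight to each edge. -/
abbrev LGraph : Type := Edge → ℝ

/-- The norm of a labeled graph: the sum of the absolute values of its edge weights. -/
noncomputable def gnorm (w : LGraph) : ℝ≥0∞ := ∑' e : Edge, ENNReal.ofReal |w e|

/-- A labeled graph has finite norm if its norm is finite. -/
def FiniteNorm (w : LGraph) : Prop := gnorm w ≠ ⊤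

/-- The distance between two labeled graphs: `d(w,w') = |w - w'|`. -/
noncomputable def ldist (w w' : LGraph) : ℝ≥0∞ := ∑' e : Edge, ENNReal.ofReal |w e - w' e|

/-- A vertex is isolated if every edge containing it has weight `0`. -/
def Isolated (w : LGraph) (v : ℕ) : Prop := ∀ e : Edge, v ∈ e.val → w e = 0

/-- A labeled graph is standard if it has infinitely many isolated vertices. -/
def Standard (w : LGraph) : Prop := {v : ℕ | Isolated w v}.Infinite

/-- The image of an edge under a bijection of the vertex set. -/
def mapEdge (f : ℕ ≃ ℕ) (e : Edge) : Edge :=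
  ⟨e.val.map f, fun h => e.prop ((Sym2.isDiag_map f.injective).mp h)⟩

/-- Two labeled graphs are isomorphic if some bijection of the vertices carries the
weights of one to the other: `w(uv) = w'(f(u)f(v))` for all edges `uv`. -/
def GIso (w w' : LGraph) : Prop := ∃ f : ℕ ≃ ℕ, ∀ e : Edge, w e = w' (mapEdge f e)

/-- The isomorphism class of a labeled graph (as a set of labeled graphs). -/
def cls (w : LGraph) : Set LGraph := {w' | GIso w w'}

/-- The distance between the isomorphism classes of two labeled graphs:
`d(G,G') = inf { d(u,v) : u ∈ G, v ∈ G' }`. -/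
noncomputable def Gdist (w₁ w₂ : LGraph) : ℝ≥0∞ := ⨅ u ∈ cls w₁, ⨅ v ∈ cls w₂, ldist u v

theorem mapEdge_symm_mapEdge (f : ℕ ≃ ℕ) (e : Edge) : mapEdge f.symm (mapEdge f e) = e := by
  apply Subtype.ext
  simp [mapEdge, Sym2.map_map]

theorem mapEdge_mapEdge (f g : ℕ ≃ ℕ) (e : Edge) :
    mapEdge g (mapEdge f e) = mapEdge (f.trans g) e := by
  apply Subtype.ext
  simp [mapEdge, Sym2.map_map]

/-- The permutation of the edges induced by a permutation of the vertices. -/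
def edgeEquiv (f : ℕ ≃ ℕ) : Edge ≃ Edge where
  toFun := mapEdge f
  invFun := mapEdge f.symm
  left_inv := mapEdge_symm_mapEdge f
  right_inv := mapEdge_symm_mapEdge f.symm

theorem GIso.refl (w : LGraph) : GIso w w :=
  ⟨Equiv.refl ℕ, fun e => by congr 1; apply Subtype.ext; simp [mapEdge]⟩

theorem GIso.symm {w w' : LGraph} (h : GIso w w') : GIso w' w := by
  obtain ⟨f, hf⟩ := h
  refine ⟨f.symm, fun e => ?_⟩
  rw [hf, ← mapEdge_symm_mapEdge f.symm e]
  simp only [Equiv.symm_symm, mapEdge_symm_mapEdge]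

theorem GIso.trans {w₁ w₂ w₃ : LGraph} (h : GIso w₁ w₂) (h' : GIso w₂ w₃) : GIso w₁ w₃ := by
  obtain ⟨f, hf⟩ := h
  obtain ⟨g, hg⟩ := h'
  exact ⟨f.trans g, fun e => by rw [hf, hg, mapEdge_mapEdge]⟩

theorem Gdist_le_ldist {w₁ w₂ u v : LGraph} (hu : GIso w₁ u) (hv : GIso w₂ v) :
    Gdist w₁ w₂ ≤ ldist u v :=
  (iInf₂_le u hu).trans (iInf₂_le v hv)

/-- A graph at distance less than `r` from the class of `c` has a relabeling at distance
less than `r` from `c` itself. -/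
theorem exists_GIso_ldist_lt {c w : LGraph} {r : ℝ≥0∞} (h : Gdist c w < r) :
    ∃ v, GIso w v ∧ ldist c v < r := by
  simp only [Gdist, iInf_lt_iff] at h
  obtain ⟨u, ⟨f, hf⟩, v, hv, huv⟩ := h
  refine ⟨fun e => v (mapEdge f e), hv.trans (GIso.symm ⟨f, fun e => rfl⟩), ?_⟩
  have : ldist c (fun e => v (mapEdge f e)) = ldist u v := by
    unfold ldist
    simp only [hf]
    exact (edgeEquiv f).tsum_eq (fun e => ENNReal.ofReal |u e - v e|)
  rwa [this]

/-- The edge map induced by `n ↦ 2 * n`. -/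
def doubleEdge (e : Edge) : Edge :=
  ⟨e.val.map (2 * ·), fun h =>
    e.prop ((Sym2.isDiag_map (mul_right_injective₀ two_ne_zero)).mp h)⟩

theorem doubleEdge_injective : Function.Injective doubleEdge := fun _ _ h =>
  Subtype.ext (Sym2.map.injective (mul_right_injective₀ two_ne_zero) (congrArg Subtype.val h))

/-- The copy of a labeled graph on the even vertices. -/
noncomputable def double (w : LGraph) : LGraph := Function.extend doubleEdge w 0

theorem double_doubleEdge (w : LGraph) (e : Edge) : double w (doubleEdge e) = w e :=
  doubleEdge_injective.extend_apply _ _ _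

theorem double_of_notMem (w : LGraph) {e : Edge} (h : ¬ ∃ e', doubleEdge e' = e) :
    double w e = 0 :=
  Function.extend_apply' _ _ _ h

theorem double_eq_zero_of_odd (w : LGraph) {e : Edge} {n : ℕ} (hn : 2 * n + 1 ∈ e.val) :
    double w e = 0 := by
  apply double_of_notMem
  rintro ⟨e', rfl⟩
  obtain ⟨m, -, hm⟩ := Sym2.mem_map.mp hn
  omega

theorem ldist_double (w w' : LGraph) : ldist (double w) (double w') = ldist w w' := by
  unfold ldist
  rw [← doubleEdge_injective.tsum_eq]
  · simp only [double_doubleEdge]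
  · intro e he
    by_contra h
    exact he (by simp [double_of_notMem _ h])

theorem gnorm_eq_ldist_zero (w : LGraph) : gnorm w = ldist w 0 := by
  simp [gnorm, ldist]

theorem double_zero : double 0 = 0 := by
  funext e
  by_cases h : ∃ e', doubleEdge e' = e
  · obtain ⟨e', rfl⟩ := h
    rw [double_doubleEdge]; rfl
  · exact double_of_notMem _ h

theorem gnorm_double (w : LGraph) : gnorm (double w) = gnorm w := by
  rw [gnorm_eq_ldist_zero, gnorm_eq_ldist_zero, ← ldist_double w 0, double_zero]

theorem infinite_odd : {v : ℕ | ∃ n, v = 2 * n + 1}.Infinite :=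
  Set.infinite_of_injective_forall_mem (f := fun n : ℕ => 2 * n + 1)
    (fun a b h => by simpa using h) fun n => ⟨n, rfl⟩

/-- An injective map between co-infinite subsets of `ℕ` extends to a permutation. -/
theorem exists_equiv_extending (g : ℕ → ℕ) (hg : Function.Injective g) (S : Set ℕ)
    (hS : Sᶜ.Infinite) (hT : (g '' S)ᶜ.Infinite) :
    ∃ f : ℕ ≃ ℕ, (∀ n ∈ S, f n = g n) ∧ ∀ n ∉ S, f n ∉ g '' S := by
  classical
  have := hS.to_subtype
  have := hT.to_subtype
  obtain ⟨i⟩ := nonempty_denumerable (Sᶜ : Set ℕ)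
  obtain ⟨j⟩ := nonempty_denumerable ((g '' S)ᶜ : Set ℕ)
  let e : (Sᶜ : Set ℕ) ≃ ((g '' S)ᶜ : Set ℕ) := Denumerable.equiv₂ _ _
  refine ⟨(Equiv.Set.sumCompl S).symm.trans
    (((Equiv.Set.image g S hg).sumCongr e).trans (Equiv.Set.sumCompl (g '' S))), ?_, ?_⟩
  · intro n hn
    simp [Equiv.Set.sumCompl_symm_apply_of_mem hn]
  · intro n hn
    simp only [Equiv.trans_apply, Equiv.Set.sumCompl_symm_apply_of_notMem hn,
      Equiv.sumCongr_apply, Sum.map_inr, Equiv.Set.sumCompl_apply_inr]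
    exact (e ⟨n, hn⟩).prop

theorem Standard.GIso_double {w : LGraph} (hw : Standard w) : GIso w (double w) := by
  obtain ⟨f, hf, hf'⟩ := exists_equiv_extending (2 * ·) (mul_right_injective₀ two_ne_zero)
    {v | Isolated w v}ᶜ (by rwa [compl_compl])
    (infinite_odd.mono (by
      rintro _ ⟨n, rfl⟩ ⟨m, -, hm⟩
      simp only at hm
      omega))
  refine ⟨f, fun e => ?_⟩
  by_cases h : ∃ v ∈ e.val, Isolated w v
  · obtain ⟨v, hve, hv⟩ := h
    rw [hv e hve]
    by_cases h' : ∃ e', doubleEdge e' = mapEdge f e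
    · obtain ⟨e', he'⟩ := h'
      rw [← he', double_doubleEdge]
      have hmem : f v ∈ (doubleEdge e').val := by
        rw [he']
        exact Sym2.mem_map.mpr ⟨v, hve, rfl⟩
      obtain ⟨m, hm, hmv⟩ := Sym2.mem_map.mp hmem
      have := hf' v (fun h => h hv)
      by_contra hne
      exact this ⟨m, fun hi => hne (hi e' hm).symm, hmv⟩
    · exact (double_of_notMem _ h').symm
  · have : mapEdge f e = doubleEdge e := by
      apply Subtype.ext
      exact Sym2.map_congr fun v hv => hf v fun hi => h ⟨v, hv, hi⟩
    rw [this, double_doubleEdge]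

theorem tsum_ofReal_abs_lincomb_le (a b : ℝ) (x y z : LGraph) :
    ∑' e, ENNReal.ofReal |a * (x e - z e) + b * (y e - z e)| ≤
      ENNReal.ofReal |a| * ldist z x + ENNReal.ofReal |b| * ldist z y := by
  unfold ldist
  rw [← ENNReal.tsum_mul_left, ← ENNReal.tsum_mul_left, ← ENNReal.tsum_add]
  refine ENNReal.tsum_le_tsum fun e => ?_
  rw [← ENNReal.ofReal_mul (abs_nonneg a), ← ENNReal.ofReal_mul (abs_nonneg b),
    ← ENNReal.ofReal_add (by positivity) (by positivity), ← abs_mul, ← abs_mul]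
  refine ENNReal.ofReal_le_ofReal ((abs_add_le _ _).trans (le_of_eq ?_))
  rw [abs_mul, abs_mul, abs_mul, abs_mul, abs_sub_comm (x e), abs_sub_comm (y e)]

theorem gnorm_le_add_ldist (w w' : LGraph) : gnorm w' ≤ gnorm w + ldist w w' := by
  unfold gnorm ldist
  rw [← ENNReal.tsum_add]
  refine ENNReal.tsum_le_tsum fun e => ?_
  rw [← ENNReal.ofReal_add (abs_nonneg _) (abs_nonneg _)]
  refine ENNReal.ofReal_le_ofReal ?_
  have := abs_sub (w e) (w e - w' e)
  rwa [sub_sub_cancel] at this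

/-- The path which runs straight from `x` to `z` and then straight from `z` to `y`. -/
def brokenLine (x z y : LGraph) (t : ℝ) : LGraph := fun e =>
  z e + max (1 - 2 * t) 0 * (x e - z e) + max (2 * t - 1) 0 * (y e - z e)

theorem ldist_brokenLine_le (x z y : LGraph) {t : ℝ} (h0 : 0 ≤ t) (h1 : t ≤ 1) :
    ldist z (brokenLine x z y t) ≤ max (ldist z x) (ldist z y) := by
  have key := tsum_ofReal_abs_lincomb_le (max (1 - 2 * t) 0) (max (2 * t - 1) 0) x y z
  have h : ldist z (brokenLine x z y t) = ∑' e, ENNReal.ofReal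
      |max (1 - 2 * t) 0 * (x e - z e) + max (2 * t - 1) 0 * (y e - z e)| := by
    unfold ldist
    congr! 3 with e
    rw [abs_sub_comm]
    unfold brokenLine
    congr 1
    ring
  rw [h]
  refine key.trans ?_
  rw [abs_of_nonneg (le_max_right _ _), abs_of_nonneg (le_max_right _ _)]
  calc _ ≤ ENNReal.ofReal (max (1 - 2 * t) 0) * max (ldist z x) (ldist z y) +
        ENNReal.ofReal (max (2 * t - 1) 0) * max (ldist z x) (ldist z y) := by
        gcongr
        · exact le_max_left _ _
        · exact le_max_right _ _
    _ = ENNReal.ofReal (max (1 - 2 * t) 0 + max (2 * t - 1) 0) *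
          max (ldist z x) (ldist z y) := by
        rw [ENNReal.ofReal_add (le_max_right _ _) (le_max_right _ _), add_mul]
    _ ≤ 1 * max (ldist z x) (ldist z y) := by
        gcongr
        rw [ENNReal.ofReal_le_one]
        rcases max_cases (1 - 2 * t) 0 with h | h <;>
          rcases max_cases (2 * t - 1) 0 with h' | h' <;> linarith
    _ = _ := one_mul _

theorem ldist_brokenLine_brokenLine_le (x z y : LGraph) (s t : ℝ) :
    ldist (brokenLine x z y s) (brokenLine x z y t) ≤
      ENNReal.ofReal (2 * |s - t|) * (ldist z x + ldist z y) := by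
  have key := tsum_ofReal_abs_lincomb_le (max (1 - 2 * s) 0 - max (1 - 2 * t) 0)
    (max (2 * s - 1) 0 - max (2 * t - 1) 0) x y z
  have h : ldist (brokenLine x z y s) (brokenLine x z y t) = ∑' e, ENNReal.ofReal
      |(max (1 - 2 * s) 0 - max (1 - 2 * t) 0) * (x e - z e) +
        (max (2 * s - 1) 0 - max (2 * t - 1) 0) * (y e - z e)| := by
    unfold ldist brokenLine
    congr! 3 with e
    congr 1
    ring
  rw [h, mul_add]
  refine key.trans ?_
  have h2 : |2 * (s - t)| = 2 * |s - t| := by rw [abs_mul, abs_two]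
  gcongr
  · refine (abs_max_sub_max_le_abs _ _ _).trans (le_of_eq ?_)
    rw [← h2, ← abs_neg]
    congr 1
    ring
  · refine (abs_max_sub_max_le_abs _ _ _).trans (le_of_eq ?_)
    rw [← h2]
    congr 1
    ring

theorem brokenLine_zero (x z y : LGraph) : brokenLine x z y 0 = x := by
  funext e
  norm_num [brokenLine]

theorem brokenLine_one (x z y : LGraph) : brokenLine x z y 1 = y := by
  funext e
  norm_num [brokenLine]

theorem standard_brokenLine_double (x z y : LGraph) (t : ℝ) :
    Standard (brokenLine (double x) (double z) (double y) t) := by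
  refine infinite_odd.mono ?_
  rintro _ ⟨n, rfl⟩ e he
  simp [brokenLine, double_eq_zero_of_odd _ he]

theorem GIso.standard {w w' : LGraph} (h : GIso w w') (hw : Standard w) : Standard w' := by
  obtain ⟨f, hf⟩ := h.symm
  refine (hw.image f.symm.injective.injOn).mono ?_
  rintro _ ⟨v, hv, rfl⟩ e he
  rw [hf]
  exact hv _ (Sym2.mem_map.mpr ⟨f.symm v, he, f.apply_symm_apply v⟩)

theorem exists_pos_ofReal_mul_lt {C eps : ℝ≥0∞} (hC : C ≠ ⊤) (heps : 0 < eps) :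
    ∃ δ : ℝ, 0 < δ ∧ ∀ x < δ, ENNReal.ofReal (2 * x) * C < eps := by
  have hcont : Tendsto (fun x : ℝ => ENNReal.ofReal (2 * x) * C) (𝓝 0) (𝓝 0) := by
    have h : Tendsto (fun x : ℝ => ENNReal.ofReal (2 * x)) (𝓝 0) (𝓝 0) := by
      have : Continuous fun x : ℝ => ENNReal.ofReal (2 * x) :=
        ENNReal.continuous_ofReal.comp (continuous_const_mul 2)
      simpa using this.tendsto 0
    simpa using ENNReal.Tendsto.mul_const h (Or.inr hC)
  obtain ⟨δ, hδ, h⟩ := Metric.eventually_nhds_iff.mp (hcont.eventually_lt_const heps)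
  refine ⟨δ, hδ, fun x hx => ?_⟩
  rcases le_total x 0 with hx0 | hx0
  · rw [ENNReal.ofReal_of_nonpos (by linarith), zero_mul]
    exact heps
  · exact h (by rwa [Real.dist_0_eq_abs, abs_of_nonneg hx0])

/-- `𝒢₀` is locally path connected: every open ball is path connected. -/
theorem G0_locallyPathConnected (c : LGraph) (hcs : Standard c) (hcf : FiniteNorm c)
    (r : ℝ) (hr : 0 < r)
    (w w' : LGraph) (hs : Standard w) (hf : FiniteNorm w)
    (hs' : Standard w') (hf' : FiniteNorm w')
    (hw : Gdist c w < ENNReal.ofReal r) (hw' : Gdist c w' < ENNReal.ofReal r) :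
    ∃ γ : ℝ → LGraph,
      (∀ t ∈ Set.Icc (0 : ℝ) 1,
        Standard (γ t) ∧ FiniteNorm (γ t) ∧ Gdist c (γ t) < ENNReal.ofReal r) ∧
      GIso (γ 0) w ∧ GIso (γ 1) w' ∧
      ∀ t ∈ Set.Icc (0 : ℝ) 1, ∀ eps : ℝ≥0∞, 0 < eps → ∃ δ : ℝ, 0 < δ ∧
        ∀ s ∈ Set.Icc (0 : ℝ) 1, |s - t| < δ → Gdist (γ s) (γ t) < eps := by
  obtain ⟨x, hwx, hx⟩ := exists_GIso_ldist_lt hw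
  obtain ⟨y, hwy, hy⟩ := exists_GIso_ldist_lt hw'
  have hmax : ∀ t ∈ Set.Icc (0 : ℝ) 1,
      ldist (double c) (brokenLine (double x) (double c) (double y) t) < ENNReal.ofReal r :=
    fun t ht => (ldist_brokenLine_le _ _ _ ht.1 ht.2).trans_lt
      (max_lt (by rwa [ldist_double]) (by rwa [ldist_double]))
  refine ⟨brokenLine (double x) (double c) (double y), fun t ht => ⟨?_, ?_, ?_⟩, ?_, ?_, ?_⟩
  · exact standard_brokenLine_double x c y t
  · refine ne_top_of_le_ne_top ?_ (gnorm_le_add_ldist (double c) _)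
    rw [gnorm_double]
    exact ENNReal.add_ne_top.mpr ⟨hcf, (hmax t ht).ne_top⟩
  · exact (Gdist_le_ldist hcs.GIso_double (GIso.refl _)).trans_lt (hmax t ht)
  · rw [brokenLine_zero]
    exact (hwx.trans (hwx.standard hs).GIso_double).symm
  · rw [brokenLine_one]
    exact (hwy.trans (hwy.standard hs').GIso_double).symm
  · intro t _ eps heps
    obtain ⟨δ, hδ, h⟩ := exists_pos_ofReal_mul_lt
      (C := ldist (double c) (double x) + ldist (double c) (double y))
      (by rw [ldist_double, ldist_double]; exact ENNReal.add_ne_top.mpr ⟨hx.ne_top, hy.ne_top⟩)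
      heps
    exact ⟨δ, hδ, fun s _ hst => (Gdist_le_ldist (GIso.refl _) (GIso.refl _)).trans_lt
      ((ldist_brokenLine_brokenLine_le _ _ _ s t).trans_lt (h _ hst))⟩
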